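/- For every even integer m ≥ 2, 2 · ζ(m, 1) = m · ζ(m+1) − 2 · ∑_{i,k ≥ 1, i+2k = m} ζ(i+1) · ζ(2k). -/

import Mathlib

open scoped BigOperators

/-- Multiple zeta value `ζ(k_1,…,k_r) = ∑_{m_1 > ⋯ > m_r > 0} 1/(m_1^{k_1} ⋯ m_r^{k_r})`;
for a single argument this is the Riemann zeta value. -/
noncomputable def mzv (ks : List ℕ) : ℝ :=
  ∑' m : Fin ks.length → ℕ,
    if (∀ i, 0 < m i) ∧ (∀ i j, i < j → m j < m i) then
      1 / ∏ i, (m i : ℝ) ^ ks.get i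
    else 0

lemma mzv_singleton (k : ℕ) : mzv [k] = ∑' n : ℕ, 1 / ((n : ℝ) + 1) ^ k := by
  have hinj : Function.Injective (fun (n : ℕ) (_ : Fin 1) => n + 1) := by
    intro a b h
    simpa using congrFun h 0
  have h := hinj.tsum_eq (f := fun m : Fin 1 → ℕ =>
    if (∀ i, 0 < m i) ∧ (∀ i j, i < j → m j < m i) then
      1 / ∏ i, (m i : ℝ) ^ [k].get i else 0) (by
    intro v hv
    have hv0 : 0 < v 0 := by
      by_contra hn
      exact hv (if_neg fun hc => hn (hc.1 0))
    refine ⟨v 0 - 1, funext fun i => ?_⟩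
    fin_cases i
    exact Nat.sub_add_cancel hv0)
  refine h.symm.trans (tsum_congr fun n => ?_)
  simp [Subsingleton.elim _ (0 : Fin 1)]

lemma summable_one_div_succ_pow {k : ℕ} (hk : 2 ≤ k) :
    Summable fun n : ℕ => 1 / ((n : ℝ) + 1) ^ k := by
  have h := (summable_nat_add_iff 1).2 (Real.summable_one_div_nat_pow.2 hk)
  simpa using h

/-- The harmonic number `1 + 1/2 + ⋯ + 1/n` as a real number. -/
noncomputable def realHarmonic (n : ℕ) : ℝ := ∑ j ∈ Finset.range n, 1 / ((j : ℝ) + 1)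

lemma realHarmonic_succ (n : ℕ) : realHarmonic (n + 1) = realHarmonic n + 1 / ((n : ℝ) + 1) :=
  Finset.sum_range_succ _ _

lemma realHarmonic_nonneg (n : ℕ) : 0 ≤ realHarmonic n :=
  Finset.sum_nonneg fun _ _ => by positivity

lemma realHarmonic_le_two_mul_sqrt (n : ℕ) : realHarmonic n ≤ 2 * √n := by
  induction n with
  | zero => simp [realHarmonic]
  | succ n ih =>
    rw [realHarmonic_succ]
    push_cast
    have hn : (0 : ℝ) < n + 1 := by positivity
    have ha := Real.sq_sqrt (Nat.cast_nonneg (α := ℝ) n)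
    have hb := Real.sq_sqrt hn.le
    have hb0 := Real.sqrt_pos.2 hn
    have ha0 := Real.sqrt_nonneg (n : ℝ)
    have hab : √(n : ℝ) ≤ √((n : ℝ) + 1) := Real.sqrt_le_sqrt (by linarith)
    set a := √(n : ℝ)
    set b := √((n : ℝ) + 1)
    have hb1 : 1 ≤ b := by nlinarith
    have key : 1 / ((n : ℝ) + 1) ≤ 2 * (b - a) := by
      rw [div_le_iff₀ hn, ← hb]
      have h1 : (b - a) * (b + a) = 1 := by nlinarith
      have h2 : b + a ≤ 2 * b ^ 2 := by nlinarith
      nlinarith [mul_le_mul_of_nonneg_left h2 (sub_nonneg.2 hab)]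
    linarith

lemma summable_realHarmonic_div {k : ℕ} (hk : 2 ≤ k) :
    Summable fun n : ℕ => realHarmonic n / ((n : ℝ) + 1) ^ k := by
  have h : Summable fun n : ℕ => 2 * (1 / ((n : ℝ) + 1) ^ (3 / 2 : ℝ)) := by
    have h := (summable_nat_add_iff 1).2 (Real.summable_one_div_nat_rpow.2
      (by norm_num : (1 : ℝ) < 3 / 2))
    simpa using h.mul_left 2
  refine Summable.of_nonneg_of_le (fun n => div_nonneg (realHarmonic_nonneg n) (by positivity))
    (fun n => ?_) h
  have hn : (0 : ℝ) < n + 1 := by positivity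
  have hs : realHarmonic n ≤ 2 * √((n : ℝ) + 1) :=
    (realHarmonic_le_two_mul_sqrt n).trans (by gcongr; linarith)
  calc realHarmonic n / ((n : ℝ) + 1) ^ k
      ≤ 2 * √((n : ℝ) + 1) / ((n : ℝ) + 1) ^ 2 := by
        gcongr
        linarith
    _ = 2 * (1 / ((n : ℝ) + 1) ^ (3 / 2 : ℝ)) := by
        have h2 : ((n : ℝ) + 1) ^ 2 = ((n : ℝ) + 1) ^ (3 / 2 : ℝ) * √((n : ℝ) + 1) := by
          rw [Real.sqrt_eq_rpow, ← Real.rpow_add hn, ← Real.rpow_natCast]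
          norm_num
        rw [h2]
        have := Real.sqrt_pos.2 hn
        field_simp

lemma mzv_pair_one {k : ℕ} (hk : 2 ≤ k) :
    mzv [k, 1] = ∑' n : ℕ, realHarmonic n / ((n : ℝ) + 1) ^ k := by
  have hinj : Function.Injective
      (fun (x : Σ n : ℕ, Fin n) => (![x.1 + 1, (x.2 : ℕ) + 1] : Fin 2 → ℕ)) := by
    rintro ⟨n, i⟩ ⟨n', i'⟩ h
    have h0 : n = n' := by simpa using congrFun h 0
    subst h0
    have h1 : (i : ℕ) = i' := by simpa using congrFun h 1
    rw [Fin.ext h1]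
  have h := hinj.tsum_eq (f := fun m : Fin 2 → ℕ =>
    if (∀ i, 0 < m i) ∧ (∀ i j, i < j → m j < m i) then
      1 / ∏ i, (m i : ℝ) ^ [k, 1].get i else 0) (by
    intro v hv
    have hc : (∀ i, 0 < v i) ∧ (∀ i j, i < j → v j < v i) := by
      by_contra hn
      exact hv (if_neg hn)
    have h1 := hc.1 1
    have h01 := hc.2 0 1 (by decide)
    refine ⟨⟨v 0 - 1, ⟨v 1 - 1, by omega⟩⟩, funext fun i => ?_⟩
    fin_cases i
    · exact Nat.sub_add_cancel (h1.trans h01)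
    · exact Nat.sub_add_cancel h1)
  have hterm : ∀ x : Σ n : ℕ, Fin n,
      (if (∀ i, 0 < (![x.1 + 1, (x.2 : ℕ) + 1] : Fin 2 → ℕ) i) ∧
          (∀ i j, i < j → (![x.1 + 1, (x.2 : ℕ) + 1] : Fin 2 → ℕ) j <
            (![x.1 + 1, (x.2 : ℕ) + 1] : Fin 2 → ℕ) i) then
        1 / ∏ i, ((![x.1 + 1, (x.2 : ℕ) + 1] : Fin 2 → ℕ) i : ℝ) ^ [k, 1].get i else 0)
      = (1 / (((x.2 : ℕ) : ℝ) + 1)) / ((x.1 : ℝ) + 1) ^ k := by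
    rintro ⟨n, i⟩
    rw [if_pos]
    · simp [Fin.prod_univ_two, div_eq_mul_inv]
    · refine ⟨fun j => by fin_cases j <;> simp, fun j l hjl => ?_⟩
      fin_cases j <;> fin_cases l <;> simp at hjl ⊢
  have hfib : ∀ n : ℕ, ∑' i : Fin n, (1 / (((i : ℕ) : ℝ) + 1)) / ((n : ℝ) + 1) ^ k
      = realHarmonic n / ((n : ℝ) + 1) ^ k := by
    intro n
    rw [tsum_fintype, ← Finset.sum_div, realHarmonic, Finset.sum_range]
  refine (h.symm.trans (tsum_congr hterm)).trans ?_
  have hsum : Summable fun x : Σ n : ℕ, Fin n =>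
      (1 / (((x.2 : ℕ) : ℝ) + 1)) / ((x.1 : ℝ) + 1) ^ k := by
    refine (summable_sigma_of_nonneg fun x => by positivity).2 ⟨fun n => ?_, ?_⟩
    · exact Summable.of_finite
    · exact (summable_realHarmonic_div hk).congr fun n => (hfib n).symm
  rw [hsum.tsum_sigma]
  exact tsum_congr hfib

lemma hasSum_sub_shift (u : ℕ → ℝ) (hu : Filter.Tendsto u Filter.atTop (nhds 0)) (P : ℕ)
    (hnn : ∀ n, 0 ≤ u n - u (n + P)) :
    HasSum (fun n => u n - u (n + P)) (∑ j ∈ Finset.range P, u j) := by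
  rw [hasSum_iff_tendsto_nat_of_nonneg hnn]
  have hpart : ∀ N, ∑ n ∈ Finset.range N, (u n - u (n + P))
      = ∑ j ∈ Finset.range P, u j - ∑ j ∈ Finset.range P, u (N + j) := by
    intro N
    have h1 := Finset.sum_range_add u N P
    have h2 := Finset.sum_range_add u P N
    simp only [Nat.add_comm P] at h2
    rw [Finset.sum_sub_distrib]
    linarith
  simp only [hpart]
  have h0 : Filter.Tendsto (fun N => ∑ j ∈ Finset.range P, u (N + j)) Filter.atTop (nhds 0) := by
    simpa using tendsto_finsetSum (Finset.range P)
      fun j _ => hu.comp (Filter.tendsto_add_atTop_nat j)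
  simpa using h0.const_sub (∑ j ∈ Finset.range P, u j)

lemma hasSum_one_div_mul_add (p : ℕ) :
    HasSum (fun d : ℕ => 1 / (((p : ℝ) + 1 + (d + 1)) * ((d : ℝ) + 1)))
      (realHarmonic (p + 1) / ((p : ℝ) + 1)) := by
  have hu : Filter.Tendsto (fun n : ℕ => 1 / ((n : ℝ) + 1)) Filter.atTop (nhds 0) :=
    tendsto_one_div_add_atTop_nhds_zero_nat
  have h := (hasSum_sub_shift _ hu (p + 1) fun n => by
    rw [sub_nonneg]
    gcongr
    simp).div_const ((p : ℝ) + 1)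
  refine (h.congr_fun fun d => ?_)
  push_cast
  have hd : (d : ℝ) + 1 ≠ 0 := by positivity
  have hp : (p : ℝ) + 1 ≠ 0 := by positivity
  have hpd : (p : ℝ) + 1 + (d + 1) ≠ 0 := by positivity
  have hdp : (d : ℝ) + (p + 1) + 1 ≠ 0 := by positivity
  field_simp
  ring
  
/-- A symmetric sum over pairs splits into its diagonal and twice its part above the diagonal. -/
lemma tsum_prod_symm (f : ℕ × ℕ → ℝ) (hf : Summable f) (hsymm : ∀ x, f x.swap = f x) :
    ∑' x, f x = ∑' n, f (n, n) + 2 * ∑' x : ℕ × ℕ, f (x.1, x.1 + x.2 + 1) := by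
  have hd : Function.Injective fun n : ℕ => (n, n) := fun a b h => (Prod.ext_iff.1 h).1
  have hu : Function.Injective fun x : ℕ × ℕ => (x.1, x.1 + x.2 + 1) := by
    rintro ⟨a, b⟩ ⟨c, d⟩ h
    simp only [Prod.mk.injEq] at h ⊢
    omega
  have hl : Function.Injective fun x : ℕ × ℕ => (x.1 + x.2 + 1, x.1) := by
    rintro ⟨a, b⟩ ⟨c, d⟩ h
    simp only [Prod.mk.injEq] at h ⊢
    omega
  have e : ∀ x, f x = {x : ℕ × ℕ | x.1 = x.2}.indicator f x
      + ({x : ℕ × ℕ | x.1 < x.2}.indicator f x + {x : ℕ × ℕ | x.2 < x.1}.indicator f x) := by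
    intro x
    rcases lt_trichotomy x.1 x.2 with h | h | h
    · simp [Set.indicator, h, h.ne, not_lt.2 h.le]
    · simp [Set.indicator, h]
    · simp [Set.indicator, h, h.ne', not_lt.2 h.le]
  rw [tsum_congr e, (hf.indicator _).tsum_add ((hf.indicator _).add (hf.indicator _)),
    (hf.indicator _).tsum_add (hf.indicator _)]
  have h0 := hd.tsum_eq (f := {x : ℕ × ℕ | x.1 = x.2}.indicator f) (by
    rintro ⟨a, b⟩ h
    have := Set.mem_of_indicator_ne_zero h
    exact ⟨a, by simpa using this⟩)
  have h1 := hu.tsum_eq (f := {x : ℕ × ℕ | x.1 < x.2}.indicator f) (by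
    rintro ⟨a, b⟩ h
    have : a < b := (Set.mem_of_indicator_ne_zero h :)
    exact ⟨(a, b - a - 1), Prod.ext rfl (by simp only; omega)⟩)
  have h2 := hl.tsum_eq (f := {x : ℕ × ℕ | x.2 < x.1}.indicator f) (by
    rintro ⟨a, b⟩ h
    have : b < a := (Set.mem_of_indicator_ne_zero h :)
    exact ⟨(b, a - b - 1), Prod.ext (by simp only; omega) rfl⟩)
  rw [← h0, ← h1, ← h2, two_mul]
  congr 1
  · exact tsum_congr fun n => by simp [Set.indicator]
  congr 1
  · refine tsum_congr fun x => Set.indicator_of_mem ?_ f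
    simp only [Set.mem_ofPred_eq]; omega
  · refine tsum_congr fun x => ?_
    rw [Set.indicator_of_mem (by simp only [Set.mem_ofPred_eq]; omega)]
    exact hsymm (x.1, x.1 + x.2 + 1)

lemma summable_one_div_pow_mul_one_div_pow {a b : ℕ} (ha : 2 ≤ a) (hb : 2 ≤ b) :
    Summable fun x : ℕ × ℕ => 1 / ((x.1 : ℝ) + 1) ^ a * (1 / ((x.2 : ℝ) + 1) ^ b) :=
  (summable_one_div_succ_pow ha).mul_of_nonneg (summable_one_div_succ_pow hb)
    (fun _ => by positivity) fun _ => by positivity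

lemma mzv_mul_mzv {a b : ℕ} (ha : 2 ≤ a) (hb : 2 ≤ b) :
    mzv [a] * mzv [b] =
      ∑' x : ℕ × ℕ, 1 / ((x.1 : ℝ) + 1) ^ a * (1 / ((x.2 : ℝ) + 1) ^ b) := by
  rw [mzv_singleton, mzv_singleton]
  exact (summable_one_div_succ_pow ha).tsum_mul_tsum (summable_one_div_succ_pow hb)
    (summable_one_div_pow_mul_one_div_pow ha hb)

lemma hasSum_mul_succ_pow {k : ℕ} (hk : 1 ≤ k) :
    HasSum (fun x : ℕ × ℕ => 1 / (((x.1 : ℝ) + 1) ^ k *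
        (((x.1 : ℝ) + 1 + (x.2 + 1)) * ((x.2 : ℝ) + 1))))
      (mzv [k + 2] + mzv [k + 1, 1]) := by
  have hfib : ∀ p : ℕ, HasSum (fun d : ℕ => 1 / (((p : ℝ) + 1) ^ k *
      (((p : ℝ) + 1 + (d + 1)) * ((d : ℝ) + 1))))
      (1 / ((p : ℝ) + 1) ^ (k + 2) + realHarmonic p / ((p : ℝ) + 1) ^ (k + 1)) := by
    intro p
    have h := (hasSum_one_div_mul_add p).mul_left (1 / ((p : ℝ) + 1) ^ k)
    have hp : (p : ℝ) + 1 ≠ 0 := by positivity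
    have e : 1 / ((p : ℝ) + 1) ^ k * (realHarmonic (p + 1) / ((p : ℝ) + 1)) =
        1 / ((p : ℝ) + 1) ^ (k + 2) + realHarmonic p / ((p : ℝ) + 1) ^ (k + 1) := by
      rw [realHarmonic_succ]
      field_simp
      ring
    rw [e] at h
    exact h.congr_fun fun d => by rw [one_div_mul_one_div]
  have h1 := (summable_one_div_succ_pow (k := k + 2) (by omega)).hasSum
  have h2 := (summable_realHarmonic_div (k := k + 1) (by omega)).hasSum
  rw [← mzv_singleton] at h1
  rw [← mzv_pair_one (by omega)] at h2
  have h := h1.add h2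
  have hs : Summable fun x : ℕ × ℕ => 1 / (((x.1 : ℝ) + 1) ^ k *
      (((x.1 : ℝ) + 1 + (x.2 + 1)) * ((x.2 : ℝ) + 1))) := by
    refine (summable_prod_of_nonneg fun x => by positivity).2 ⟨fun p => (hfib p).summable, ?_⟩
    exact h.summable.congr fun p => (hfib p).tsum_eq.symm
  rw [← (hs.hasSum.prod_fiberwise hfib).unique h]
  exact hs.hasSum

lemma sum_antidiagonal_one_div_mul (n : ℕ) :
    ∑ x ∈ Finset.HasAntidiagonal.antidiagonal n, 1 / (((x.1 : ℝ) + 1) * ((x.2 : ℝ) + 1)) =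
      2 * realHarmonic (n + 1) / ((n : ℝ) + 2) := by
  have hsplit : ∀ x ∈ Finset.HasAntidiagonal.antidiagonal n,
      1 / (((x.1 : ℝ) + 1) * ((x.2 : ℝ) + 1)) =
      (1 / ((x.1 : ℝ) + 1) + 1 / ((x.2 : ℝ) + 1)) / ((n : ℝ) + 2) := by
    intro x hx
    have hn : (n : ℝ) = x.1 + x.2 := by
      rw [← Finset.HasAntidiagonal.mem_antidiagonal.1 hx]
      push_cast
      rfl
    rw [hn]
    field_simp
    ring
  have hfst : ∑ x ∈ Finset.HasAntidiagonal.antidiagonal n, 1 / ((x.1 : ℝ) + 1) =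
      realHarmonic (n + 1) :=
    Finset.Nat.sum_antidiagonal_eq_sum_range_succ (fun i _ => 1 / ((i : ℝ) + 1)) n
  have hsnd : ∑ x ∈ Finset.HasAntidiagonal.antidiagonal n, 1 / ((x.2 : ℝ) + 1) =
      realHarmonic (n + 1) := by
    rw [← hfst, ← Finset.Nat.sum_antidiagonal_swap]
    rfl
  rw [Finset.sum_congr rfl hsplit, ← Finset.sum_div, Finset.sum_add_distrib, hfst, hsnd, two_mul]

lemma tsum_add_pow_mul {k : ℕ} (hk : 1 ≤ k)
    (hs : Summable fun x : ℕ × ℕ => 1 / (((x.1 : ℝ) + 1 + (x.2 + 1)) ^ k *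
      (((x.1 : ℝ) + 1) * ((x.2 : ℝ) + 1)))) :
    ∑' x : ℕ × ℕ, 1 / (((x.1 : ℝ) + 1 + (x.2 + 1)) ^ k *
      (((x.1 : ℝ) + 1) * ((x.2 : ℝ) + 1))) = 2 * mzv [k + 1, 1] := by
  have hfib : ∀ n : ℕ, ∑' x : Finset.HasAntidiagonal.antidiagonal n,
      1 / (((x.1.1 : ℝ) + 1 + (x.1.2 + 1)) ^ k * (((x.1.1 : ℝ) + 1) * ((x.1.2 : ℝ) + 1))) =
      2 * (realHarmonic (n + 1) / (((n + 1 : ℕ) : ℝ) + 1) ^ (k + 1)) := by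
    intro n
    rw [tsum_fintype, Finset.sum_coe_sort (Finset.HasAntidiagonal.antidiagonal n)
      (fun x : ℕ × ℕ =>
      1 / (((x.1 : ℝ) + 1 + (x.2 + 1)) ^ k * (((x.1 : ℝ) + 1) * ((x.2 : ℝ) + 1))))]
    have hn : ((n + 1 : ℕ) : ℝ) + 1 = n + 2 := by
      push_cast
      ring
    have hterm : ∀ x ∈ Finset.HasAntidiagonal.antidiagonal n,
        1 / (((x.1 : ℝ) + 1 + (x.2 + 1)) ^ k * (((x.1 : ℝ) + 1) * ((x.2 : ℝ) + 1))) =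
        1 / ((n : ℝ) + 2) ^ k * (1 / (((x.1 : ℝ) + 1) * ((x.2 : ℝ) + 1))) := by
      intro x hx
      have hx' : (x.1 : ℝ) + 1 + (x.2 + 1) = n + 2 := by
        rw [← Finset.HasAntidiagonal.mem_antidiagonal.1 hx]
        push_cast
        ring
      rw [hx', one_div_mul_one_div]
    rw [Finset.sum_congr rfl hterm, ← Finset.mul_sum, sum_antidiagonal_one_div_mul, hn]
    field_simp
    ring
  have hsig := Finset.HasAntidiagonal.sigmaAntidiagonalEquivProd.summable_iff.2 hs
  rw [← Finset.HasAntidiagonal.sigmaAntidiagonalEquivProd.tsum_eq]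
  refine hsig.tsum_sigma.trans ((tsum_congr hfib).trans ?_)
  rw [tsum_mul_left, mzv_pair_one (by omega),
    (summable_realHarmonic_div (k := k + 1) (by omega)).tsum_eq_zero_add]
  simp [realHarmonic]

lemma partialFraction_geom (n : ℕ) {P D : ℝ} (hP : 0 < P) (hD : 0 < D) :
    ∑ i ∈ Finset.range n, 1 / P ^ (i + 2) * (1 / (P + D) ^ (n - 1 - i + 2)) =
      1 / (P ^ (n + 1) * ((P + D) * D)) - 1 / ((P + D) ^ (n + 1) * (P * D)) := by
  have hQ : 0 < P + D := by positivity
  have h := geom_sum₂_mul (1 / P) (1 / (P + D)) n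
  have hxy : 1 / P - 1 / (P + D) = D / (P * (P + D)) := by
    field_simp
    ring
  rw [hxy, mul_div_assoc', div_eq_iff (by positivity)] at h
  have h1 : ∑ i ∈ Finset.range n, 1 / P ^ (i + 2) * (1 / (P + D) ^ (n - 1 - i + 2)) =
      1 / (P ^ 2 * (P + D) ^ 2) *
        ∑ i ∈ Finset.range n, (1 / P) ^ i * (1 / (P + D)) ^ (n - 1 - i) := by
    rw [Finset.mul_sum]
    refine Finset.sum_congr rfl fun i _ => ?_
    rw [one_div_pow, one_div_pow, pow_add, pow_add]
    field_simp
  rw [h1, ← mul_right_inj' hD.ne', mul_left_comm, mul_comm D (Finset.sum _ _), h]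
  simp only [one_div_pow]
  field_simp
  ring

/-- Euler's formula for the double zeta values `ζ(n + 2, 1)`. -/
lemma euler_sum_mzv_mul_mzv (n : ℕ) :
    ∑ i ∈ Finset.range n, mzv [i + 2] * mzv [n - 1 - i + 2] =
      ((n : ℝ) + 2) * mzv [n + 3] - 2 * mzv [n + 2, 1] := by
  have hsum : ∀ i ∈ Finset.range n, Summable fun x : ℕ × ℕ =>
      1 / ((x.1 : ℝ) + 1) ^ (i + 2) * (1 / ((x.2 : ℝ) + 1) ^ (n - 1 - i + 2)) :=
    fun i _ => summable_one_div_pow_mul_one_div_pow (by omega) (by omega)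
  have hf := summable_sum hsum
  rw [Finset.sum_congr rfl fun i _ => mzv_mul_mzv (a := i + 2) (b := n - 1 - i + 2)
    (by omega) (by omega), ← Summable.tsum_finsetSum hsum, tsum_prod_symm _ hf]
  · have hdiag : ∀ p : ℕ, ∑ i ∈ Finset.range n,
        1 / ((p : ℝ) + 1) ^ (i + 2) * (1 / ((p : ℝ) + 1) ^ (n - 1 - i + 2)) =
        n * (1 / ((p : ℝ) + 1) ^ (n + 3)) := by
      intro p
      rw [Finset.sum_congr rfl (g := fun _ => 1 / ((p : ℝ) + 1) ^ (n + 3)), Finset.sum_const,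
        Finset.card_range, nsmul_eq_mul]
      intro i hi
      have hi' := Finset.mem_range.1 hi
      rw [one_div_mul_one_div, ← pow_add]
      congr 2
      omega
    have hA := hasSum_mul_succ_pow (k := n + 1) (by omega)
    have hinj : Function.Injective fun x : ℕ × ℕ => (x.1, x.1 + x.2 + 1) := by
      rintro ⟨a, b⟩ ⟨c, d⟩ h
      simp only [Prod.mk.injEq] at h ⊢
      omega
    have hoff : ∀ x : ℕ × ℕ, ∑ i ∈ Finset.range n, 1 / ((x.1 : ℝ) + 1) ^ (i + 2) *
          (1 / (((x.1 + x.2 + 1 : ℕ) : ℝ) + 1) ^ (n - 1 - i + 2)) =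
        1 / (((x.1 : ℝ) + 1) ^ (n + 1) * (((x.1 : ℝ) + 1 + (x.2 + 1)) * ((x.2 : ℝ) + 1))) -
        1 / (((x.1 : ℝ) + 1 + (x.2 + 1)) ^ (n + 1) * (((x.1 : ℝ) + 1) * ((x.2 : ℝ) + 1))) := by
      intro x
      rw [← partialFraction_geom n (by positivity) (by positivity)]
      push_cast
      refine Finset.sum_congr rfl fun i _ => ?_
      congr 3
      ring
    have hS := (hf.comp_injective hinj).congr hoff
    have hB := (hA.summable.sub hS).congr fun x => (sub_sub_cancel _ _)
    rw [tsum_congr hdiag, tsum_congr hoff, tsum_mul_left, ← mzv_singleton,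
      hA.summable.tsum_sub hB, hA.tsum_eq, tsum_add_pow_mul (by omega) hB]
    ring
  · intro x
    rw [← Finset.sum_range_reflect]
    refine Finset.sum_congr rfl fun i hi => ?_
    have hi' := Finset.mem_range.1 hi
    rw [mul_comm, show n - 1 - (n - 1 - i) = i by omega]
    rfl

lemma sum_range_two_mul_of_reflect (t : ℕ) (g : ℕ → ℝ)
    (hg : ∀ i < 2 * t, g (2 * t - 1 - i) = g i) :
    ∑ i ∈ Finset.range (2 * t), g i = 2 * ∑ j ∈ Finset.range t, g (2 * j) := by
  have hsplit : ∀ s : ℕ, ∑ i ∈ Finset.range (2 * s), g i =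
      ∑ j ∈ Finset.range s, g (2 * j) + ∑ j ∈ Finset.range s, g (2 * j + 1) := by
    intro s
    induction s with
    | zero => simp
    | succ s ih =>
      rw [Nat.mul_succ, Finset.sum_range_succ, Finset.sum_range_succ, ih, Finset.sum_range_succ,
        Finset.sum_range_succ]
      ring
  rw [hsplit, two_mul, ← Finset.sum_range_reflect (fun j => g (2 * j + 1))]
  congr 1
  refine Finset.sum_congr rfl fun j hj => ?_
  have hj' := Finset.mem_range.1 hj
  rw [← hg (2 * j) (by omega)]
  congr 1
  omega

/-- For even `m ≥ 2`:  `2·ζ(m,1) = m·ζ(m+1) − 2·∑_{i,k ≥ 1, i+2k=m} ζ(i+1)·ζ(2k)`. -/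
theorem double_zeta_relation_even (m : ℕ) (hm : 2 ≤ m) (heven : Even m) :
    2 * mzv [m, 1] =
      (m : ℝ) * mzv [m + 1] -
        2 * ∑ p ∈ (Finset.range (m + 1) ×ˢ Finset.range (m + 1)).filter
            (fun p => 1 ≤ p.1 ∧ 1 ≤ p.2 ∧ p.1 + 2 * p.2 = m),
          mzv [p.1 + 1] * mzv [2 * p.2] := by
  obtain ⟨s, rfl⟩ := heven
  obtain ⟨t, rfl⟩ : ∃ t, s = t + 1 := ⟨s - 1, by omega⟩
  have hE := euler_sum_mzv_mul_mzv (2 * t)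
  rw [sum_range_two_mul_of_reflect t] at hE
  · have hreindex : ∑ p ∈ (Finset.range (t + 1 + (t + 1) + 1) ×ˢ
          Finset.range (t + 1 + (t + 1) + 1)).filter
            (fun p => 1 ≤ p.1 ∧ 1 ≤ p.2 ∧ p.1 + 2 * p.2 = t + 1 + (t + 1)),
          mzv [p.1 + 1] * mzv [2 * p.2] =
        ∑ j ∈ Finset.range t, mzv [2 * j + 2] * mzv [2 * t - 1 - 2 * j + 2] := by
      refine Finset.sum_bij' (fun p _ => p.2 - 1) (fun j _ => (2 * t - 2 * j, j + 1))
        ?_ ?_ ?_ ?_ ?_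
      all_goals simp only [Finset.mem_filter, Finset.mem_product, Finset.mem_range, Prod.forall,
        Prod.mk.injEq]
      · omega
      · omega
      · omega
      · omega
      · intro a b h
        rw [mul_comm, show 2 * (b - 1) + 2 = 2 * b by omega,
          show 2 * t - 1 - 2 * (b - 1) + 2 = a + 1 by omega]
    rw [hreindex, hE, show t + 1 + (t + 1) = 2 * t + 2 by omega]
    push_cast
    ring
  · intro i hi
    rw [show 2 * t - 1 - (2 * t - 1 - i) = i by omega, mul_comm]
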